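/- arXiv:1812.08584 — 5 statements merged into one kernel-verified Lean document; each statement's English description precedes it below -/
import Mathlib

section
/- Let X be a metric space and u ∈ 𝔉(X). Then lim_{α→0⁺} d_H([u]_α, [u]_0) = 0; equivalently, for every ε > 0 there exists α ∈ (0,1] such that d_H([u]_α, [u]_0) < ε. -/
open Set Metric Filter Topology
open scoped Classical

noncomputable section

/-- The `α`-cut `[u]_α = {x | u x ≥ α}` of a fuzzy set for `α ∈ (0,1]`,
and its support `[u]_0 = closure {x | u x > 0}` for `α = 0`. -/
def fcut {X : Type*} [TopologicalSpace X] (u : X → ℝ) (α : ℝ) : Set X :=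
  if α = 0 then closure {x | 0 < u x} else {x | α ≤ u x}

/-- `u ∈ 𝔉(X)`: an upper semicontinuous fuzzy set (with values in `[0,1]`)
whose support is compact and whose `1`-cut is nonempty. -/
def IsFuzzy {X : Type*} [TopologicalSpace X] (u : X → ℝ) : Prop :=
  UpperSemicontinuous u ∧ (∀ x, u x ∈ Icc (0 : ℝ) 1) ∧
    IsCompact (fcut u 0) ∧ (fcut u 1).Nonempty

/-- The level-wise metric `d_∞(u,v) = sup{d_H([u]_α, [v]_α) : α ∈ [0,1]}`. -/
def dInfty {X : Type*} [MetricSpace X] (u v : X → ℝ) : ℝ :=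
  ⨆ α : Icc (0 : ℝ) 1, hausdorffDist (fcut u α.1) (fcut v α.1)

/-- `t ∈ Hom(I)`: a strictly increasing homeomorphism of `I = [0,1]` onto itself
(recorded as a map `ℝ → ℝ`, considered on `[0,1]`). -/
def IsHomI (t : ℝ → ℝ) : Prop :=
  StrictMonoOn t (Icc 0 1) ∧ ContinuousOn t (Icc 0 1) ∧
    MapsTo t (Icc 0 1) (Icc 0 1) ∧ SurjOn t (Icc 0 1) (Icc 0 1)

/-- The Skorokhod metric
`d_0(u,v) = inf{ε > 0 : ∃ t ∈ Hom(I), sup_{x ∈ I} |t x - x| ≤ ε and d_∞(u, t∘v) ≤ ε}`. -/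
def dSk {X : Type*} [MetricSpace X] (u v : X → ℝ) : ℝ :=
  sInf {ε : ℝ | 0 < ε ∧ ∃ t : ℝ → ℝ, IsHomI t ∧
    (∀ x ∈ Icc (0 : ℝ) 1, |t x - x| ≤ ε) ∧ dInfty u (t ∘ v) ≤ ε}

/-- Zadeh's extension of `f`: `f̃(u)(x) = sup{u z : z ∈ f⁻¹(x)}`, which is `0`
when `f⁻¹(x) = ∅` since `sSup ∅ = 0` in `ℝ`. -/
def zadeh {X : Type*} (f : X → X) (u : X → ℝ) : X → ℝ :=
  fun x => sSup (u '' (f ⁻¹' {x}))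

/-- Sufficiently low cuts of a fuzzy set are within `ε` of its support. -/
theorem eventually_hausdorffDist_fcut_lt {X : Type*} [MetricSpace X] {u : X → ℝ}
    (hu : IsCompact (fcut u 0)) {ε : ℝ} (hε : 0 < ε) :
    ∀ᶠ α in 𝓝[>] (0 : ℝ), hausdorffDist (fcut u α) (fcut u 0) < ε := by
  have h_zero : fcut u 0 = closure {x | 0 < u x} := by simp [fcut]
  have htb : TotallyBounded {x | 0 < u x} :=
    hu.totallyBounded.subset (h_zero ▸ subset_closure)
  obtain ⟨t, htu, htf, hcover⟩ := htb.exists_subset (dist_mem_uniformity (half_pos hε))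
  have hlow : ∀ᶠ α in 𝓝[>] (0 : ℝ), ∀ y ∈ t, α ≤ u y :=
    (htf.eventually_all).2 fun y hy =>
      nhdsWithin_le_nhds ((eventually_lt_nhds (htu hy)).mono fun _ h => h.le)
  filter_upwards [hlow, self_mem_nhdsWithin] with α hα hpos
  have hpos : 0 < α := hpos
  rw [h_zero, hausdorffDist_closure₂, fcut, if_neg hpos.ne']
  refine (hausdorffDist_le_of_mem_dist (half_pos hε).le
    (fun x hx => ⟨x, hpos.trans_le hx, by simpa using (half_pos hε).le⟩)
    fun x hx => ?_).trans_lt (half_lt_self hε)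
  obtain ⟨y, hy, hxy⟩ := mem_iUnion₂.1 (hcover hx)
  exact ⟨y, hα y hy, le_of_lt hxy⟩

/-- `lim_{α → 0⁺} d_H([u]_α, [u]_0) = 0`; equivalently, for every `ε > 0` there exists
`α ∈ (0,1]` such that `d_H([u]_α, [u]_0) < ε`. -/
theorem statement1 {X : Type*} [MetricSpace X] (u : X → ℝ) (hu : IsFuzzy u) :
    Tendsto (fun α : ℝ => hausdorffDist (fcut u α) (fcut u 0)) (𝓝[Ioc (0 : ℝ) 1] 0) (𝓝 0) ∧
    ∀ ε : ℝ, 0 < ε → ∃ α ∈ Ioc (0 : ℝ) 1, hausdorffDist (fcut u α) (fcut u 0) < ε := by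
  have key := fun (ε : ℝ) (hε : 0 < ε) =>
    eventually_hausdorffDist_fcut_lt hu.2.2.1 hε
  refine ⟨?_, fun ε hε => ?_⟩
  · refine Tendsto.mono_left (Metric.tendsto_nhds.2 fun ε hε => ?_)
      (nhdsWithin_mono 0 (Ioc_subset_Ioi_self : Ioc (0 : ℝ) 1 ⊆ Ioi 0))
    filter_upwards [key ε hε] with α hα
    rwa [Real.dist_0_eq_abs, abs_of_nonneg hausdorffDist_nonneg]
  · obtain ⟨α, hα, hmem⟩ := ((key ε hε).and (Ioc_mem_nhdsGT (zero_lt_one' ℝ))).exists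
    exact ⟨α, hmem, hα⟩
end
end

section
/- Let X be a Hausdorff topological space, f : X → X a continuous map, and u ∈ 𝔉(X). Then for every α ∈ (0,1], the α-cut of Zadeh's extension satisfies [f̃(u)]_α = f([u]_α), and the support satisfies [f̃(u)]_0 = f([u]_0). -/
open Set Metric Filter
open scoped Classical

noncomputable section

lemma le_zadeh {X : Type*} (f : X → X) {u : X → ℝ} (hu : ∀ x, u x ≤ 1) (z : X) :
    u z ≤ zadeh f u (f z) :=
  le_csSup ⟨1, by rintro _ ⟨y, -, rfl⟩; exact hu y⟩ ⟨z, rfl, rfl⟩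

/-- A positive value of Zadeh's extension is attained on the fibre. -/
lemma exists_eq_zadeh_of_pos {X : Type*} [TopologicalSpace X] [T1Space X] {f : X → X}
    (hf : Continuous f) {u : X → ℝ} (husc : UpperSemicontinuous u)
    (hsupp : IsCompact (closure {x | 0 < u x})) {x : X} (hx : 0 < zadeh f u x) :
    ∃ z, f z = x ∧ u z = zadeh f u x := by
  have hne : (u '' (f ⁻¹' {x})).Nonempty := by
    by_contra! h
    simp [zadeh, h] at hx
  obtain ⟨_, ⟨y, hy, rfl⟩, hypos⟩ := exists_lt_of_lt_csSup hne hx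
  have hK : IsCompact (closure {x | 0 < u x} ∩ f ⁻¹' {x}) :=
    hsupp.inter_right (isClosed_singleton.preimage hf)
  have hyK : y ∈ closure {x | 0 < u x} ∩ f ⁻¹' {x} := ⟨subset_closure hypos, hy⟩
  obtain ⟨z, hz, hmax⟩ := UpperSemicontinuousOn.exists_isMaxOn ⟨y, hyK⟩ hK
    (husc.upperSemicontinuousOn _)
  rw [isMaxOn_iff] at hmax
  have hzpos : 0 < u z := hypos.trans_le (hmax y hyK)
  have hgreatest : IsGreatest (u '' (f ⁻¹' {x})) (u z) := by
    refine ⟨⟨z, hz.2, rfl⟩, ?_⟩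
    rintro _ ⟨w, hw, rfl⟩
    rcases le_or_gt (u w) 0 with h | h
    · exact h.trans hzpos.le
    · exact hmax w ⟨subset_closure h, hw⟩
  exact ⟨z, hz.2, hgreatest.csSup_eq.symm⟩

/-- For a continuous map `f` on a Hausdorff space, the `α`-cut of Zadeh's extension
satisfies `[f̃(u)]_α = f([u]_α)` for `α ∈ (0,1]`, and `[f̃(u)]_0 = f([u]_0)`. -/
theorem statement3 {X : Type*} [TopologicalSpace X] [T2Space X]
    (f : X → X) (hf : Continuous f) (u : X → ℝ) (hu : IsFuzzy u) :
    (∀ α ∈ Ioc (0 : ℝ) 1, fcut (zadeh f u) α = f '' fcut u α) ∧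
    fcut (zadeh f u) 0 = f '' fcut u 0 := by
  obtain ⟨husc, hI, hsupp, -⟩ := hu
  have hle := le_zadeh f fun x => (hI x).2
  simp only [fcut, if_true] at hsupp ⊢
  refine ⟨fun α hα => ?_, ?_⟩
  · simp only [hα.1.ne', if_false]
    ext x
    constructor
    · intro hx
      obtain ⟨z, rfl, hz⟩ := exists_eq_zadeh_of_pos hf husc hsupp (hα.1.trans_le hx)
      exact ⟨z, hx.trans_eq hz.symm, rfl⟩
    · rintro ⟨z, hz, rfl⟩
      exact le_trans hz (hle z)
  · rw [image_closure_of_isCompact hsupp hf.continuousOn]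
    congr 1
    ext x
    constructor
    · intro hx
      obtain ⟨z, rfl, hz⟩ := exists_eq_zadeh_of_pos hf husc hsupp hx
      exact ⟨z, hx.trans_eq hz.symm, rfl⟩
    · rintro ⟨z, hz, rfl⟩
      exact lt_of_lt_of_le hz (hle z)
end
end

section
/- Let X be a metric space, let λ ∈ [0,1), and let f : X → X satisfy d(f(x), f(y)) ≤ λ·d(x,y) for all x, y ∈ X. Then for all u, v ∈ 𝔉(X) and every t ∈ Hom(I), d_∞(f̃(u), t∘f̃(v)) ≤ λ·d_∞(u, t∘v). -/
open Set Metric Filter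
open scoped Classical

noncomputable section

theorem fcut_zero {X : Type*} [TopologicalSpace X] (u : X → ℝ) :
    fcut u 0 = closure {x | 0 < u x} := if_pos rfl

theorem fcut_of_pos {X : Type*} [TopologicalSpace X] (u : X → ℝ) {α : ℝ} (hα : 0 < α) :
    fcut u α = {x | α ≤ u x} := if_neg hα.ne'

theorem fcut_subset_support {X : Type*} [TopologicalSpace X] (u : X → ℝ) {α : ℝ}
    (hα : 0 ≤ α) : fcut u α ⊆ fcut u 0 := by
  rcases hα.eq_or_lt with rfl | hα
  · rfl
  · rw [fcut_of_pos u hα, fcut_zero]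
    exact fun x hx => subset_closure (hα.trans_le hx)

theorem IsFuzzy.isCompact_fcut {X : Type*} [TopologicalSpace X] {u : X → ℝ} (hu : IsFuzzy u)
    {α : ℝ} (hα : 0 ≤ α) : IsCompact (fcut u α) := by
  refine hu.2.2.1.of_isClosed_subset ?_ (fcut_subset_support u hα)
  rcases hα.eq_or_lt with rfl | hα
  · rw [fcut_zero]
    exact isClosed_closure
  · rw [fcut_of_pos u hα]
    exact hu.1.isClosed_preimage α

theorem IsFuzzy.nonempty_fcut {X : Type*} [TopologicalSpace X] {u : X → ℝ} (hu : IsFuzzy u)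
    {α : ℝ} (hα : α ∈ Icc (0 : ℝ) 1) : (fcut u α).Nonempty := by
  rcases hα.1.eq_or_lt with rfl | h0
  · exact hu.2.2.2.mono (fcut_subset_support u zero_le_one)
  · refine hu.2.2.2.mono fun x hx => ?_
    rw [fcut_of_pos u one_pos] at hx
    rw [fcut_of_pos u h0]
    exact hα.2.trans hx

theorem bddAbove_image_of_mem_Icc {X : Type*} {u : X → ℝ} (hu : ∀ x, u x ∈ Icc (0 : ℝ) 1)
    (s : Set X) : BddAbove (u '' s) := by
  refine ⟨1, ?_⟩
  rintro _ ⟨x, -, rfl⟩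
  exact (hu x).2

theorem le_zadeh_apply {X : Type*} {u : X → ℝ} (hu : ∀ x, u x ∈ Icc (0 : ℝ) 1) (f : X → X)
    (x : X) : u x ≤ zadeh f u (f x) :=
  le_csSup (bddAbove_image_of_mem_Icc hu _) ⟨x, rfl, rfl⟩

theorem exists_pos_of_zadeh_pos {X : Type*} {u : X → ℝ} {f : X → X} {x : X}
    (h : 0 < zadeh f u x) : ∃ z, f z = x ∧ 0 < u z := by
  by_contra! H
  refine h.not_ge (Real.sSup_nonpos ?_)
  rintro _ ⟨z, hz, rfl⟩
  exact H z hz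

theorem zadeh_mem_Icc {X : Type*} {u : X → ℝ} (hu : ∀ x, u x ∈ Icc (0 : ℝ) 1) (f : X → X)
    (x : X) : zadeh f u x ∈ Icc (0 : ℝ) 1 := by
  constructor
  · refine Real.sSup_nonneg ?_
    rintro _ ⟨z, -, rfl⟩
    exact (hu z).1
  · refine Real.sSup_le ?_ zero_le_one
    rintro _ ⟨z, -, rfl⟩
    exact (hu z).2

/-- A positive value of Zadeh's extension is attained on the fibre. -/
theorem IsFuzzy.exists_zadeh_le {X : Type*} [TopologicalSpace X] [T1Space X] {u : X → ℝ}
    (hu : IsFuzzy u) {f : X → X} (hf : Continuous f) {x : X} (h : 0 < zadeh f u x) :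
    ∃ z, f z = x ∧ zadeh f u x ≤ u z := by
  obtain ⟨w, hw, hw0⟩ := exists_pos_of_zadeh_pos h
  have hsupp : ∀ z, 0 < u z → z ∈ fcut u 0 := fun z hz => by
    rw [fcut_zero]
    exact subset_closure hz
  obtain ⟨z, hz, hmax⟩ := (hu.1.upperSemicontinuousOn _).exists_isMaxOn
    (s := fcut u 0 ∩ f ⁻¹' {x}) ⟨w, hsupp w hw0, hw⟩
    (hu.2.2.1.inter_right (isClosed_singleton.preimage hf))
  refine ⟨z, hz.2, csSup_le ⟨_, w, hw, rfl⟩ ?_⟩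
  rintro _ ⟨y, hy, rfl⟩
  by_cases hy0 : 0 < u y
  · exact hmax ⟨hsupp y hy0, hy⟩
  · exact (not_lt.1 hy0).trans (hu.2.1 z).1

/-- The cuts of Zadeh's extension are the images of the cuts. -/
theorem IsFuzzy.fcut_zadeh {X : Type*} [TopologicalSpace X] [T2Space X] {u : X → ℝ}
    (hu : IsFuzzy u) {f : X → X} (hf : Continuous f) {α : ℝ} (hα : 0 ≤ α) :
    fcut (zadeh f u) α = f '' fcut u α := by
  rcases hα.eq_or_lt with rfl | hα
  · have himage : {x | 0 < zadeh f u x} = f '' {x | 0 < u x} := by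
      ext x
      constructor
      · intro hx
        obtain ⟨z, hz, hz0⟩ := exists_pos_of_zadeh_pos hx
        exact ⟨z, hz0, hz⟩
      · rintro ⟨z, hz, rfl⟩
        exact lt_of_lt_of_le hz (le_zadeh_apply hu.2.1 f z)
    have hcomp := hu.2.2.1
    rw [fcut_zero] at hcomp
    rw [fcut_zero, fcut_zero, himage]
    exact (closure_minimal (image_mono subset_closure) (hcomp.image hf).isClosed).antisymm
      (image_closure_subset_closure_image hf)
  · rw [fcut_of_pos _ hα, fcut_of_pos _ hα]
    ext x
    constructor
    · intro hx
      obtain ⟨z, hz, hle⟩ := hu.exists_zadeh_le hf (hα.trans_le hx)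
      exact ⟨z, le_trans hx hle, hz⟩
    · rintro ⟨z, hz, rfl⟩
      exact le_trans hz (le_zadeh_apply hu.2.1 f z)

theorem IsHomI.map_zero {t : ℝ → ℝ} (ht : IsHomI t) : t 0 = 0 := by
  obtain ⟨s, hs, hs0⟩ := ht.2.2.2 (left_mem_Icc.2 zero_le_one)
  refine le_antisymm ?_ (ht.2.2.1 (left_mem_Icc.2 zero_le_one)).1
  exact hs0 ▸ ht.1.monotoneOn (left_mem_Icc.2 zero_le_one) hs hs.1

/-- Reparametrizing the values of a fuzzy set reparametrizes its cuts. -/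
theorem IsHomI.fcut_comp {X : Type*} [TopologicalSpace X] {t : ℝ → ℝ} (ht : IsHomI t)
    {w : X → ℝ} (hw : ∀ x, w x ∈ Icc (0 : ℝ) 1) {s : ℝ} (hs : s ∈ Icc (0 : ℝ) 1) :
    fcut (t ∘ w) (t s) = fcut w s := by
  have h0 : (0 : ℝ) ∈ Icc (0 : ℝ) 1 := left_mem_Icc.2 zero_le_one
  rcases hs.1.eq_or_lt with rfl | hpos
  · rw [ht.map_zero, fcut_zero, fcut_zero]
    congr 1
    ext x
    have := ht.1.lt_iff_lt h0 (hw x)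
    rwa [ht.map_zero] at this
  · have htpos : 0 < t s := ht.map_zero ▸ ht.1 h0 hs hpos
    rw [fcut_of_pos _ htpos, fcut_of_pos _ hpos]
    ext x
    exact ht.1.le_iff_le hs (hw x)

theorem hausdorffDist_image_le_mul {X Y : Type*} [PseudoMetricSpace X] [PseudoMetricSpace Y]
    {l : ℝ} (hl : 0 ≤ l) {f : X → Y} (hf : ∀ x y, dist (f x) (f y) ≤ l * dist x y)
    {A B : Set X} (hA : IsCompact A) (hB : IsCompact B) (hA0 : A.Nonempty) (hB0 : B.Nonempty) :
    hausdorffDist (f '' A) (f '' B) ≤ l * hausdorffDist A B := by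
  have hfin := hausdorffEDist_ne_top_of_nonempty_of_bounded hA0 hB0 hA.isBounded hB.isBounded
  have key : ∀ {C D : Set X}, IsCompact D → D.Nonempty → hausdorffEDist C D ≠ ⊤ →
      ∀ x ∈ f '' C, ∃ y ∈ f '' D, dist x y ≤ l * hausdorffDist C D := by
    rintro C D hD hD0 hCD _ ⟨x, hx, rfl⟩
    obtain ⟨y, hy, hxy⟩ := hD.exists_infDist_eq_dist hD0 x
    refine ⟨f y, mem_image_of_mem f hy, (hf x y).trans (mul_le_mul_of_nonneg_left ?_ hl)⟩
    exact hxy ▸ infDist_le_hausdorffDist_of_mem hx hCD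
  refine hausdorffDist_le_of_mem_dist (mul_nonneg hl hausdorffDist_nonneg)
    (key hB hB0 hfin) ?_
  rw [hausdorffDist_comm]
  exact key hA hA0 (hausdorffEDist_comm (s := A) (t := B) ▸ hfin)

theorem IsFuzzy.bddAbove_hausdorffDist_comp {X : Type*} [MetricSpace X] {u v : X → ℝ}
    (hu : IsFuzzy u) (hv : IsFuzzy v) {t : ℝ → ℝ} (ht : IsHomI t) :
    BddAbove (range fun α : Icc (0 : ℝ) 1 =>
      hausdorffDist (fcut u α.1) (fcut (t ∘ v) α.1)) := by
  refine ⟨diam (fcut u 0 ∪ fcut v 0), ?_⟩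
  rintro _ ⟨⟨α, hα⟩, rfl⟩
  obtain ⟨s, hs, rfl⟩ := ht.2.2.2 hα
  dsimp only
  rw [ht.fcut_comp hv.2.1 hs]
  refine (hausdorffDist_le_diam (hu.nonempty_fcut hα) (hu.isCompact_fcut hα.1).isBounded
    (hv.nonempty_fcut hs) (hv.isCompact_fcut hs.1).isBounded).trans ?_
  exact diam_mono (union_subset_union (fcut_subset_support u hα.1) (fcut_subset_support v hs.1))
    (hu.2.2.1.union hv.2.2.1).isBounded

/-- If `f` is a `λ`-contraction with `λ ∈ [0,1)`, then for all `u, v ∈ 𝔉(X)` and all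
`t ∈ Hom(I)`, `d_∞(f̃(u), t ∘ f̃(v)) ≤ λ · d_∞(u, t ∘ v)`. -/
theorem statement5 {X : Type*} [MetricSpace X] (l : ℝ) (hl0 : 0 ≤ l) (hl1 : l < 1)
    (f : X → X) (hf : ∀ x y : X, dist (f x) (f y) ≤ l * dist x y)
    (u v : X → ℝ) (hu : IsFuzzy u) (hv : IsFuzzy v) (t : ℝ → ℝ) (ht : IsHomI t) :
    dInfty (zadeh f u) (t ∘ zadeh f v) ≤ l * dInfty u (t ∘ v) := by
  have hfc : Continuous f :=
    (LipschitzWith.of_dist_le_mul (K := ⟨l, hl0⟩) hf).continuous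
  have : Nonempty (Icc (0 : ℝ) 1) := ⟨⟨0, left_mem_Icc.2 zero_le_one⟩⟩
  refine ciSup_le fun α => ?_
  refine le_trans ?_ (mul_le_mul_of_nonneg_left
    (le_ciSup (hu.bddAbove_hausdorffDist_comp hv ht) α) hl0)
  obtain ⟨α, hα⟩ := α
  obtain ⟨s, hs, rfl⟩ := ht.2.2.2 hα
  dsimp only
  rw [ht.fcut_comp (zadeh_mem_Icc hv.2.1 f) hs, ht.fcut_comp hv.2.1 hs,
    hu.fcut_zadeh hfc hα.1, hv.fcut_zadeh hfc hs.1]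
  exact hausdorffDist_image_le_mul hl0 hf (hu.isCompact_fcut hα.1) (hv.isCompact_fcut hs.1)
    (hu.nonempty_fcut hα) (hv.nonempty_fcut hs)
end
end

section
/- For the fuzzy sets u, v of the Example on I = [0,1]: for every t' ∈ Hom(I) with sup{|t'(x) − x| : x ∈ I} < 1/4, one has d_∞(u, t'∘v) ≥ 1/2. Consequently d_0(u, v) ≥ 1/4. -/
open Set Metric Filter
open scoped Classical

noncomputable section

/-- The unit interval `I = [0,1]` as a metric space. -/
abbrev I01 : Type := Set.Icc (0 : ℝ) 1

/-- `a_n = 1 - (5/8)/2^n` (so `a_0 = 3/8`). -/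
def aSeq (n : ℕ) : ℝ := 1 - 5 / 8 / 2 ^ n

/-- `a'_0 = 3/8` and `a'_n = 1 - (1/4)/2^n` for `n ≥ 1` (so `a'_1 = 7/8`). -/
def aSeq' (n : ℕ) : ℝ := if n = 0 then 3 / 8 else 1 - 1 / 4 / 2 ^ n

/-- `b'_0 = 1/8` and `b'_n = a'_n` for `n ≥ 1`. -/
def bSeq' (n : ℕ) : ℝ := if n = 0 then 1 / 8 else aSeq' n

/-- `u(x) = 0` on `[0, 3/8)`, `u(x) = a_n` on `[a'_n, a'_{n+1})`, and `u(1) = 1`. -/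
def uAux (x : ℝ) : ℝ :=
  if x = 1 then 1
  else if h : ∃ n : ℕ, aSeq' n ≤ x ∧ x < aSeq' (n + 1) then aSeq h.choose
  else 0

/-- `v(x) = 0` on `[0, 1/8)`, `v(x) = 1/8` on `[1/8, 7/8)`, `v(x) = 5/8` on `[7/8, 15/16)`,
`v(x) = a_{n-1}` on `[b'_n, b'_{n+1})` for `n ≥ 2`, and `v(1) = 1`. -/
def vAux (x : ℝ) : ℝ :=
  if x = 1 then 1
  else if x < 1 / 8 then 0
  else if x < 7 / 8 then 1 / 8
  else if x < 15 / 16 then 5 / 8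
  else if h : ∃ n : ℕ, 2 ≤ n ∧ bSeq' n ≤ x ∧ x < bSeq' (n + 1) then aSeq (h.choose - 1)
  else 0

/-- The fuzzy set `u` of the Example, as a function on `I = [0,1]`. -/
def uEx : I01 → ℝ := fun x => uAux x.1

/-- The fuzzy set `v` of the Example, as a function on `I = [0,1]`. -/
def vEx : I01 → ℝ := fun x => vAux x.1

theorem three_eighths_le_aSeq (n : ℕ) : 3 / 8 ≤ aSeq n := by
  have h : (5 / 8 : ℝ) / 2 ^ n ≤ 5 / 8 :=
    div_le_self (by norm_num) (one_le_pow₀ (by norm_num))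
  unfold aSeq
  linarith

theorem uAux_one : uAux 1 = 1 := by simp [uAux]

theorem vAux_one : vAux 1 = 1 := by simp [vAux]

theorem three_eighths_le_uAux : 3 / 8 ≤ uAux (3 / 8) := by
  have h : ∃ n : ℕ, aSeq' n ≤ 3 / 8 ∧ (3 / 8 : ℝ) < aSeq' (n + 1) :=
    ⟨0, by norm_num [aSeq'], by norm_num [aSeq']⟩
  rw [uAux, if_neg (by norm_num), dif_pos h]
  exact three_eighths_le_aSeq _

theorem vAux_mem_Icc_of_lt {x : ℝ} (hx : x < 7 / 8) : vAux x ∈ Icc (0 : ℝ) (1 / 8) := by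
  have h1 : x ≠ 1 := by rintro rfl; norm_num at hx
  rw [vAux, if_neg h1]
  by_cases h8 : x < 1 / 8
  · rw [if_pos h8]; norm_num
  · rw [if_neg h8, if_pos hx]; norm_num

theorem IsHomI.map_one {t : ℝ → ℝ} (ht : IsHomI t) : t 1 = 1 := by
  obtain ⟨hmono, -, hmaps, hsurj⟩ := ht
  have h1 : (1 : ℝ) ∈ Icc (0 : ℝ) 1 := right_mem_Icc.2 zero_le_one
  obtain ⟨x, hx, hx1⟩ := hsurj h1
  exact le_antisymm (hmaps h1).2 (hx1.ge.trans (hmono.monotoneOn hx h1 hx.2))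

theorem isHomI_id : IsHomI id :=
  ⟨strictMonoOn_id, continuousOn_id, mapsTo_id _, surjOn_id _⟩

theorem mem_fcut_of_eq_one {X : Type*} [TopologicalSpace X] {u : X → ℝ} {x : X}
    (hx : u x = 1) {α : ℝ} (hα : α ≤ 1) : x ∈ fcut u α := by
  unfold fcut
  split_ifs
  · exact subset_closure (by simp [hx])
  · simpa [hx] using hα

theorem dist_I01_le_one (x y : I01) : dist x y ≤ 1 := by
  simpa [Subtype.dist_eq] using Real.dist_le_of_mem_Icc x.2 y.2

theorem hausdorffDist_I01_le_one {s t : Set I01} (hs : s.Nonempty) (ht : t.Nonempty) :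
    hausdorffDist s t ≤ 1 := by
  obtain ⟨a, ha⟩ := hs
  obtain ⟨b, hb⟩ := ht
  exact hausdorffDist_le_of_mem_dist zero_le_one
    (fun x _ => ⟨b, hb, dist_I01_le_one x b⟩) (fun x _ => ⟨a, ha, dist_I01_le_one x a⟩)

theorem hausdorffDist_fcut_le_one {u v : I01 → ℝ} {x y : I01} (hu : u x = 1) (hv : v y = 1)
    (α : Icc (0 : ℝ) 1) : hausdorffDist (fcut u α.1) (fcut v α.1) ≤ 1 :=
  hausdorffDist_I01_le_one ⟨x, mem_fcut_of_eq_one hu α.2.2⟩ ⟨y, mem_fcut_of_eq_one hv α.2.2⟩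

theorem half_le_dInfty_of_forall_lt {t : ℝ → ℝ} (ht : IsHomI t)
    (hlt : ∀ x ∈ Icc (0 : ℝ) 1, |t x - x| < 1 / 4) :
    1 / 2 ≤ dInfty uEx (t ∘ vEx) := by
  have hu1 : uEx 1 = 1 := uAux_one
  have hv1 : (t ∘ vEx) 1 = 1 := by
    change t (vAux 1) = 1
    rw [vAux_one, ht.map_one]
  let p : I01 := ⟨3 / 8, by norm_num, by norm_num⟩
  let β : Icc (0 : ℝ) 1 := ⟨3 / 8, by norm_num, by norm_num⟩
  have hp : p ∈ fcut uEx β.1 := by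
    rw [fcut, if_neg (by norm_num [β])]
    exact three_eighths_le_uAux
  have hne : (fcut (t ∘ vEx) β.1).Nonempty := ⟨1, mem_fcut_of_eq_one hv1 β.2.2⟩
  have hfar : 1 / 2 ≤ infDist p (fcut (t ∘ vEx) β.1) := by
    refine (le_infDist hne).2 fun y hy => ?_
    rw [fcut, if_neg (by norm_num [β])] at hy
    have hy' : 3 / 8 ≤ t (vAux y.1) := hy
    have hy78 : 7 / 8 ≤ y.1 := by
      by_contra! hlow
      obtain ⟨h0, h8⟩ := vAux_mem_Icc_of_lt hlow
      have := (abs_lt.1 (hlt _ ⟨h0, by linarith⟩)).2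
      linarith
    have hd : dist p y = |3 / 8 - y.1| := rfl
    rw [hd, abs_sub_comm]
    exact le_trans (by linarith) (le_abs_self _)
  calc (1 / 2 : ℝ) ≤ infDist p (fcut (t ∘ vEx) β.1) := hfar
    _ ≤ hausdorffDist (fcut uEx β.1) (fcut (t ∘ vEx) β.1) :=
        infDist_le_hausdorffDist_of_mem hp
          (hausdorffEDist_ne_top_of_nonempty_of_bounded ⟨p, hp⟩ hne
            (Bornology.IsBounded.all _) (Bornology.IsBounded.all _))
    _ ≤ dInfty uEx (t ∘ vEx) :=
        le_ciSup (f := fun α : Icc (0 : ℝ) 1 =>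
          hausdorffDist (fcut uEx α.1) (fcut (t ∘ vEx) α.1))
          ⟨1, by rintro _ ⟨α, rfl⟩; exact hausdorffDist_fcut_le_one hu1 hv1 α⟩ β

/-- For every `t' ∈ Hom(I)` with `sup{|t'(x) - x| : x ∈ I} < 1/4` one has
`d_∞(u, t' ∘ v) ≥ 1/2`; consequently `d_0(u, v) ≥ 1/4`. -/
theorem statement8 :
    (∀ t' : ℝ → ℝ, IsHomI t' →
      (⨆ x : Icc (0 : ℝ) 1, |t' x.1 - x.1|) < 1 / 4 →
      1 / 2 ≤ dInfty uEx (t' ∘ vEx)) ∧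
    1 / 4 ≤ dSk uEx vEx := by
  refine ⟨fun t ht hsup => half_le_dInfty_of_forall_lt ht fun x hx => ?_, ?_⟩
  · refine lt_of_le_of_lt ?_ hsup
    refine le_ciSup (f := fun x : Icc (0 : ℝ) 1 => |t x.1 - x.1|) ⟨1, ?_⟩ ⟨x, hx⟩
    rintro _ ⟨y, rfl⟩
    simpa [Real.dist_eq] using Real.dist_le_of_mem_Icc (ht.2.2.1 y.2) y.2
  · refine le_csInf ⟨1, zero_lt_one, id, isHomI_id, by simp, ?_⟩ ?_
    · have : Nonempty (Icc (0 : ℝ) 1) := ⟨0⟩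
      exact ciSup_le (hausdorffDist_fcut_le_one (x := 1) (y := 1) uAux_one vAux_one)
    · rintro ε ⟨-, t, ht, hle, hd⟩
      by_contra! hε
      have := half_le_dInfty_of_forall_lt ht fun x hx => (hle x hx).trans_lt hε
      linarith
end
end

section
/- There exists a contraction f : I → I on I = [0,1] with the usual metric such that its Zadeh's extension f̃ : (𝔉(I), d_0) → (𝔉(I), d_0) is not a contraction; that is, there exists f with Lipschitz constant strictly less than 1 such that for every λ ∈ [0,1) there exist u, v ∈ 𝔉(I) with d_0(f̃(u), f̃(v)) > λ·d_0(u, v). -/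
open Set Metric Filter
open scoped Classical

noncomputable section

/-- The fuzzy set equal to `1` at `0` and to `c` elsewhere. -/
def peak (c : ℝ) : I01 → ℝ := fun x => if x = 0 then 1 else c

theorem isFuzzy_peak {c : ℝ} (h0 : 0 ≤ c) (h1 : c ≤ 1) : IsFuzzy (peak c) := by
  have hle : ∀ x, peak c x ≤ 1 := fun x => by
    unfold peak; split_ifs <;> linarith
  refine ⟨fun x y hy => ?_, fun x => ⟨?_, hle x⟩, ?_, 0, ?_⟩
  · by_cases hx : x = 0
    · have h : (1 : ℝ) < y := by simpa [peak, hx] using hy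
      exact Eventually.of_forall fun z => (hle z).trans_lt h
    · have h : c < y := by simpa [peak, hx] using hy
      filter_upwards [isOpen_ne.mem_nhds hx] with z hz
      simpa [peak, show z ≠ 0 from hz] using h
  · unfold peak; split_ifs <;> linarith
  · simp only [fcut, if_true]
    exact isClosed_closure.isCompact
  · simp [fcut, peak]

/-- The contraction `x ↦ x / 2` of the unit interval. -/
def halve : I01 → I01 := fun x => ⟨x.1 / 2, by linarith [x.2.1], by linarith [x.2.1, x.2.2]⟩

theorem halve_eq_zero_iff {x : I01} : halve x = 0 ↔ x = 0 := by
  refine ⟨fun h => Subtype.ext ?_, ?_⟩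
  · have h' : x.1 / 2 = 0 := congrArg Subtype.val h
    show x.1 = 0
    linarith
  · rintro rfl
    exact Subtype.ext (zero_div 2)

theorem halve_injective : Function.Injective halve := fun x y h => by
  have h' : x.1 / 2 = y.1 / 2 := congrArg Subtype.val h
  exact Subtype.ext (by linarith)

theorem dist_halve (x y : I01) : dist (halve x) (halve y) = 1 / 2 * dist x y := by
  simp only [Subtype.dist_eq, Real.dist_eq, halve]
  rw [← sub_div, abs_div, abs_two]
  ring

theorem zadeh_apply_of_injective {X : Type*} {f : X → X} (hf : Function.Injective f)
    (u : X → ℝ) (x : X) : zadeh f u (f x) = u x := by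
  have h : f ⁻¹' {f x} = {x} := by
    ext z; simp [hf.eq_iff]
  simp [zadeh, h]

theorem zadeh_halve_peak_zero (c : ℝ) : zadeh halve (peak c) 0 = 1 := by
  have h := zadeh_apply_of_injective halve_injective (peak c) 0
  rw [halve_eq_zero_iff.2 rfl] at h
  simpa [peak] using h

theorem zadeh_halve_peak_le {c : ℝ} (hc : 0 ≤ c) {x : I01} (hx : x ≠ 0) :
    zadeh halve (peak c) x ≤ c := by
  refine Real.sSup_le ?_ hc
  rintro _ ⟨z, hz, rfl⟩
  have hz' : halve z = x := hz
  have : z ≠ 0 := fun h => hx (by rw [← hz', halve_eq_zero_iff.2 h])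
  simp [peak, this]

theorem hausdorffDist_le_one (s t : Set I01) : hausdorffDist s t ≤ 1 := by
  rcases s.eq_empty_or_nonempty with rfl | ⟨a, ha⟩
  · simp
  rcases t.eq_empty_or_nonempty with rfl | ⟨b, hb⟩
  · simp
  have hd : ∀ x y : I01, dist x y ≤ 1 := fun x y => by
    rw [Subtype.dist_eq, Real.dist_eq, abs_le]
    constructor <;> linarith [x.2.1, x.2.2, y.2.1, y.2.2]
  exact hausdorffDist_le_of_mem_dist zero_le_one (fun x _ => ⟨b, hb, hd _ _⟩)
    (fun x _ => ⟨a, ha, hd _ _⟩)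

theorem hausdorffDist_fcut_le_dInfty (u v : I01 → ℝ) {α : ℝ} (hα : α ∈ Icc (0 : ℝ) 1) :
    hausdorffDist (fcut u α) (fcut v α) ≤ dInfty u v :=
  le_ciSup (f := fun α : Icc (0 : ℝ) 1 => hausdorffDist (fcut u α.1) (fcut v α.1))
    ⟨1, by rintro _ ⟨β, rfl⟩; exact hausdorffDist_le_one _ _⟩ ⟨α, hα⟩

theorem dInfty_self {X : Type*} [MetricSpace X] (u : X → ℝ) : dInfty u u = 0 := by
  simp [dInfty]

theorem isHomI_sq : IsHomI fun x => x ^ 2 := by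
  refine ⟨fun x hx y _ h => by
    have := hx.1
    show x ^ 2 < y ^ 2
    gcongr, by fun_prop, fun x hx => ⟨by positivity, pow_le_one₀ hx.1 hx.2⟩, fun y hy =>
    ⟨√y, ⟨Real.sqrt_nonneg y, Real.sqrt_le_one.2 hy.2⟩, Real.sq_sqrt hy.1⟩⟩

theorem dSk_peak_le : dSk (peak (1 / 4)) (peak (1 / 2)) ≤ 1 / 4 := by
  refine csInf_le ⟨0, fun ε h => h.1.le⟩ ⟨by norm_num, _, isHomI_sq, fun x hx => ?_, ?_⟩
  · rw [abs_le]
    constructor <;> nlinarith [sq_nonneg (x - 1 / 2), hx.1, hx.2]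
  · have h : (fun x : ℝ => x ^ 2) ∘ peak (1 / 2) = peak (1 / 4) := by
      funext x
      simp only [peak, Function.comp_apply]
      split_ifs <;> norm_num
    rw [h, dInfty_self]
    norm_num

theorem le_dSk_zadeh_peak :
    1 / 4 ≤ dSk (zadeh halve (peak (1 / 4))) (zadeh halve (peak (1 / 2))) := by
  refine le_csInf ⟨1, one_pos, id, isHomI_id, by simp, ?_⟩ ?_
  · exact ciSup_le fun α => hausdorffDist_le_one _ _
  rintro ε ⟨-, t, ⟨hmono, -, hmaps, -⟩, ht, hd⟩
  by_contra! hε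
  have hmem : (1 / 2 : ℝ) ∈ Icc (0 : ℝ) 1 := by norm_num
  have hα := hmaps hmem
  have hlt : 1 / 4 < t (1 / 2) := by
    have := (abs_le.1 (ht _ hmem)).1
    linarith
  have hne : t (1 / 2) ≠ 0 := by linarith
  have hu : fcut (zadeh halve (peak (1 / 4))) (t (1 / 2)) = {0} := by
    ext x
    simp only [fcut, if_neg hne, mem_ofPred_eq, mem_singleton_iff]
    refine ⟨fun h => ?_, ?_⟩
    · by_contra hx
      linarith [zadeh_halve_peak_le (by norm_num : (0 : ℝ) ≤ 1 / 4) hx]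
    · rintro rfl
      rw [zadeh_halve_peak_zero]
      exact hα.2
  have hv : halve 1 ∈ fcut (t ∘ zadeh halve (peak (1 / 2))) (t (1 / 2)) := by
    rw [fcut, if_neg hne]
    show t (1 / 2) ≤ t (zadeh halve (peak (1 / 2)) (halve 1))
    rw [zadeh_apply_of_injective halve_injective, peak, if_neg one_ne_zero]
  have hH := (hausdorffDist_fcut_le_dInfty _ _ hα).trans hd
  rw [hu, hausdorffDist_comm] at hH
  have hinf := infDist_le_hausdorffDist_of_mem hv (hausdorffEDist_ne_top_of_nonempty_of_bounded
    ⟨_, hv⟩ (singleton_nonempty (0 : I01)) (Bornology.IsBounded.all _) (Bornology.IsBounded.all _))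
  have hdist : dist (halve 1) 0 = 1 / 2 := by
    simp [Subtype.dist_eq, halve]
  rw [infDist_singleton, hdist] at hinf
  linarith

/-- There exists a contraction `f : I → I` whose Zadeh's extension
`f̃ : (𝔉(I), d_0) → (𝔉(I), d_0)` is not a contraction: for every `λ ∈ [0,1)` there are
`u, v ∈ 𝔉(I)` with `d_0(f̃(u), f̃(v)) > λ · d_0(u, v)`. -/
theorem statement12 :
    ∃ f : I01 → I01,
      (∃ l : ℝ, 0 ≤ l ∧ l < 1 ∧ ∀ x y : I01, dist (f x) (f y) ≤ l * dist x y) ∧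
      ∀ μ : ℝ, 0 ≤ μ → μ < 1 →
        ∃ u v : I01 → ℝ, IsFuzzy u ∧ IsFuzzy v ∧
          μ * dSk u v < dSk (zadeh f u) (zadeh f v) := by
  refine ⟨halve, ⟨1 / 2, by norm_num, by norm_num, fun x y => (dist_halve x y).le⟩,
    fun μ h0 h1 => ⟨peak (1 / 4), peak (1 / 2), isFuzzy_peak (by norm_num) (by norm_num),
      isFuzzy_peak (by norm_num) (by norm_num), ?_⟩⟩
  have hle := mul_le_mul_of_nonneg_left dSk_peak_le h0
  linarith [le_dSk_zadeh_peak]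
end
end
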